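/- Let t > 1 and 0 < κ < 1 be real numbers, s ≥ 1 an integer, let n ≥ 1 and 1 ≤ n1 ≤ n be integers, set λ_{N'} := M_{n1,n1−2N'}(t) · M_{2n−n1,n1−2N'}(t) / M_{2n,0}(t) for 0 ≤ N' ≤ ⌊n1/2⌋, and define the Rényi entropy S^κ_{n1}(s,t) := (1/(1−κ)) · log[ Σ_{N'=0}^{⌊n1/2⌋} s^{(1−κ)(n1−2N')} λ_{N'}^κ ]. Then n1 log s + D1(s,t) ≤ S^κ_{n1}(s,t) < n1 log s + (2κ/(2−κ)) log C(t) + (2/(2−κ)) log D4(s,t,κ/2), where D1(s,t) := −2 C(t)² log s · Σ_{N'=0}^∞ N' t^{−2N'²} and D4(s,t,κ) := Σ_{N'=0}^∞ s^{−2(1−κ)N'} t^{−2κN'²}. -/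

import Mathlib

noncomputable section

open Finset

/-- Height of the path `w` (of length `L`, up = `true`, down = `false`) after `i` steps. -/
def height {L : ℕ} (w : Fin L → Bool) (i : ℕ) : ℤ :=
  ∑ j ∈ Finset.univ.filter (fun j : Fin L => (j : ℕ) < i),
    (if w j then (1 : ℤ) else -1)

/-- `DyckSet a b`: the set `D_{a,b}` of paths of length `2a+b` with `a+b` up steps whose
heights stay nonnegative. -/
def DyckSet (a b : ℕ) : Finset (Fin (2 * a + b) → Bool) :=
  Finset.univ.filter (fun w =>
    (Finset.univ.filter (fun j => w j = true)).card = a + b ∧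
      ∀ i ≤ 2 * a + b, 0 ≤ height w i)

/-- The area `A(w)` between the path `w` and the x-axis. -/
def area {L : ℕ} (w : Fin L → Bool) : ℝ :=
  (∑ i ∈ Finset.range L, ((height w i + height w (i + 1) : ℤ) : ℝ)) / 2

/-- The weighted path sum `M_{2a+b,b}(t) = Σ_{w ∈ D_{a,b}} t^{A(w)}`. -/
def M (a b : ℕ) (t : ℝ) : ℝ := ∑ w ∈ DyckSet a b, t ^ area w

/-- `M_{ℓ,m}(t)` for `ℓ ≥ m` with `ℓ - m` even. -/
def Mlm (ℓ m : ℕ) (t : ℝ) : ℝ := M ((ℓ - m) / 2) m t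

/-- `P k`: the number of partitions of `k`. -/
def P (k : ℕ) : ℕ := Fintype.card (Nat.Partition k)

/-- `C(t) = Σ_{k=0}^∞ P(k) t^{-2k}`. -/
def C (t : ℝ) : ℝ := ∑' k : ℕ, (P k : ℝ) * t ^ (-(2 : ℝ) * k)

/-- The number of partitions of `k` with all parts at most `u`. -/
def boundedPartitions (u k : ℕ) : ℕ := (Nat.Partition.restricted k (· ≤ u)).card

lemma boundedPartitions_le (u k : ℕ) : boundedPartitions u k ≤ P k :=
  Finset.card_le_univ _

lemma boundedPartitions_eq {u k : ℕ} (h : k ≤ u) : boundedPartitions u k = P k := by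
  unfold boundedPartitions P Nat.Partition.restricted
  rw [Finset.filter_true_of_mem, Finset.card_univ]
  intro p _ i hi
  exact (Nat.Partition.le_of_mem_parts hi).trans h

lemma boundedPartitions_zero_left (k : ℕ) (hk : k ≠ 0) : boundedPartitions 0 k = 0 := by
  unfold boundedPartitions Nat.Partition.restricted
  rw [Finset.card_eq_zero, Finset.filter_eq_empty_iff]
  intro p _ h
  apply hk
  rw [← p.parts_sum]
  exact Multiset.sum_eq_zero fun i hi => Nat.le_zero.mp (h i hi)

lemma P_zero : P 0 = 1 := by
  simp [P]

lemma boundedPartitions_succ_of_lt {u k : ℕ} (h : k < u + 1) :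
    boundedPartitions (u + 1) k = boundedPartitions u k := by
  rw [boundedPartitions_eq h.le, boundedPartitions_eq (by omega)]

lemma boundedPartitions_succ_add (u k : ℕ) :
    boundedPartitions (u + 1) (k + (u + 1)) =
      boundedPartitions u (k + (u + 1)) + boundedPartitions (u + 1) k := by
  classical
  unfold boundedPartitions Nat.Partition.restricted
  rw [← Finset.card_filter_add_card_filter_not (fun p : (k + (u + 1)).Partition => u + 1 ∉ p.parts)]
  congr 1
  · congr 1
    ext p
    simp only [Finset.mem_filter, Finset.mem_univ, true_and]
    refine ⟨fun ⟨h, h'⟩ i hi => ?_, fun h => ⟨fun i hi => (h i hi).trans (Nat.le_succ u), fun h' => ?_⟩⟩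
    · rcases (h i hi).lt_or_eq with h1 | h1
      · omega
      · exact absurd (h1 ▸ hi) h'
    · have := h _ h'
      omega
  · have key : ∀ p : (k + (u + 1)).Partition, u + 1 ∈ p.parts →
        (p.parts.erase (u + 1)).sum = k := by
      intro p hp
      have h1 := Multiset.sum_erase hp
      have h2 := p.parts_sum
      omega
    refine Finset.card_bij' (fun p hp => ⟨p.parts.erase (u + 1), fun {i} hi =>
        p.parts_pos (Multiset.mem_of_mem_erase hi), key p ?_⟩)
      (fun p _ => ⟨(u + 1) ::ₘ p.parts, ?_, ?_⟩) ?_ ?_ ?_ ?_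
    · simpa using (Finset.mem_filter.mp hp).2
    · intro i hi
      rcases Multiset.mem_cons.mp hi with rfl | hi
      · omega
      · exact p.parts_pos hi
    · rw [Multiset.sum_cons, p.parts_sum, add_comm]
    · intro p hp
      simp only [Finset.mem_filter, Finset.mem_univ, true_and] at hp ⊢
      exact fun i hi => hp.1 i (Multiset.mem_of_mem_erase hi)
    · intro p hp
      simp only [Finset.mem_filter, Finset.mem_univ, true_and] at hp ⊢
      simpa using hp
    · intro p hp
      simp only [Finset.mem_filter, Finset.mem_univ, true_and, not_not] at hp
      ext1
      exact Multiset.cons_erase hp.2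
    · intro p hp
      ext1
      simp

lemma sum_boundedPartitions_le {q : ℝ} (hq0 : 0 ≤ q) (hq1 : q < 1) (K u : ℕ) :
    ∑ k ∈ range K, (boundedPartitions u k : ℝ) * q ^ k ≤ ∏ i ∈ range u, (1 - q ^ (i + 1))⁻¹ := by
  induction u with
  | zero =>
    cases K with
    | zero => simp
    | succ K =>
      rw [Finset.sum_range_succ']
      simp [boundedPartitions_zero_left, boundedPartitions_eq, P_zero]
  | succ u ih =>
    have hpos : 0 < 1 - q ^ (u + 1) := sub_pos.mpr (pow_lt_one₀ hq0 hq1 (Nat.succ_ne_zero u))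
    rw [Finset.prod_range_succ, ← div_eq_mul_inv, le_div_iff₀ hpos]
    refine le_trans ?_ ih
    have step : ∑ k ∈ range K, (boundedPartitions (u + 1) k : ℝ) * q ^ k ≤
        ∑ k ∈ range K, (boundedPartitions u k : ℝ) * q ^ k +
          q ^ (u + 1) * ∑ k ∈ range K, (boundedPartitions (u + 1) k : ℝ) * q ^ k := by
      rcases le_total K (u + 1) with hK | hK
      · refine le_add_of_le_of_nonneg (le_of_eq ?_) (by positivity)
        refine Finset.sum_congr rfl fun k hk => ?_
        rw [boundedPartitions_succ_of_lt (lt_of_lt_of_le (Finset.mem_range.mp hk) hK)]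
      · obtain ⟨J, rfl⟩ := Nat.exists_eq_add_of_le hK
        have h1 : ∑ k ∈ range (u + 1), (boundedPartitions (u + 1) k : ℝ) * q ^ k =
            ∑ k ∈ range (u + 1), (boundedPartitions u k : ℝ) * q ^ k :=
          Finset.sum_congr rfl fun k hk => by
            rw [boundedPartitions_succ_of_lt (Finset.mem_range.mp hk)]
        have h2 : ∑ k ∈ range J, (boundedPartitions (u + 1) (u + 1 + k) : ℝ) * q ^ (u + 1 + k) =
            ∑ k ∈ range J, (boundedPartitions u (u + 1 + k) : ℝ) * q ^ (u + 1 + k) +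
              q ^ (u + 1) * ∑ k ∈ range J, (boundedPartitions (u + 1) k : ℝ) * q ^ k := by
          rw [Finset.mul_sum, ← Finset.sum_add_distrib]
          refine Finset.sum_congr rfl fun k _ => ?_
          rw [add_comm (u + 1) k, boundedPartitions_succ_add]
          push_cast
          ring
        have h3 : ∑ k ∈ range J, (boundedPartitions (u + 1) k : ℝ) * q ^ k ≤
            ∑ k ∈ range (u + 1 + J), (boundedPartitions (u + 1) k : ℝ) * q ^ k :=
          Finset.sum_le_sum_of_subset_of_nonneg (Finset.range_mono (by omega))
            fun _ _ _ => by positivity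
        have h4 := mul_le_mul_of_nonneg_left h3 (pow_nonneg hq0 (u + 1))
        have h5 := Finset.sum_range_add
          (fun k => (boundedPartitions (u + 1) k : ℝ) * q ^ k) (u + 1) J
        have h6 := Finset.sum_range_add (fun k => (boundedPartitions u k : ℝ) * q ^ k) (u + 1) J
        linarith
    linarith

lemma prod_inv_one_sub_pow_le {q : ℝ} (hq0 : 0 ≤ q) (hq1 : q < 1) (u : ℕ) :
    ∏ i ∈ range u, (1 - q ^ (i + 1))⁻¹ ≤ Real.exp ((1 - q)⁻¹ * (1 - q)⁻¹) := by
  have hq : 0 < 1 - q := sub_pos.mpr hq1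
  have hterm : ∀ i ∈ range u, (1 - q ^ (i + 1))⁻¹ ≤ Real.exp (q ^ i * (1 - q)⁻¹) := by
    intro i _
    have hle : q ^ (i + 1) ≤ q := pow_le_of_le_one hq0 hq1.le (Nat.succ_ne_zero i)
    have hpos : 0 < 1 - q ^ (i + 1) := by linarith
    calc (1 - q ^ (i + 1))⁻¹ = q ^ (i + 1) * (1 - q ^ (i + 1))⁻¹ + 1 := by
          field_simp
          ring
      _ ≤ q ^ i * (1 - q)⁻¹ + 1 := by
          have := pow_le_pow_of_le_one hq0 hq1.le (Nat.le_succ i)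
          gcongr ?_ * ?_⁻¹ + 1
          linarith
      _ ≤ _ := Real.add_one_le_exp _
  calc ∏ i ∈ range u, (1 - q ^ (i + 1))⁻¹ ≤ ∏ i ∈ range u, Real.exp (q ^ i * (1 - q)⁻¹) := by
        refine Finset.prod_le_prod (fun i _ => ?_) hterm
        exact inv_nonneg.mpr (sub_nonneg.mpr (pow_le_one₀ hq0 hq1.le))
    _ = Real.exp ((∑ i ∈ range u, q ^ i) * (1 - q)⁻¹) := by
        rw [Finset.sum_mul, Real.exp_sum]
    _ ≤ _ := by
        gcongr
        rw [← tsum_geometric_of_lt_one hq0 hq1]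
        exact (summable_geometric_of_lt_one hq0 hq1).sum_le_tsum _ fun _ _ => by positivity

lemma summable_P {q : ℝ} (hq0 : 0 ≤ q) (hq1 : q < 1) :
    Summable fun k : ℕ => (P k : ℝ) * q ^ k := by
  refine summable_of_sum_range_le (c := Real.exp ((1 - q)⁻¹ * (1 - q)⁻¹))
    (fun k => by positivity) fun K => ?_
  refine le_trans (le_of_eq ?_) ((sum_boundedPartitions_le hq0 hq1 K K).trans
    (prod_inv_one_sub_pow_le hq0 hq1 K))
  exact Finset.sum_congr rfl fun k hk => by
    rw [boundedPartitions_eq (Finset.mem_range.mp hk).le]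

/-- The generating function of partitions with all parts at most `u`. -/
def boundedGen (q : ℝ) (u : ℕ) : ℝ := ∑' k : ℕ, (boundedPartitions u k : ℝ) * q ^ k

lemma summable_boundedPartitions {q : ℝ} (hq0 : 0 ≤ q) (hq1 : q < 1) (u : ℕ) :
    Summable fun k : ℕ => (boundedPartitions u k : ℝ) * q ^ k := by
  refine (summable_P hq0 hq1).of_nonneg_of_le (fun k => by positivity) fun k => ?_
  gcongr
  exact boundedPartitions_le u k

lemma boundedGen_nonneg {q : ℝ} (hq0 : 0 ≤ q) (u : ℕ) : 0 ≤ boundedGen q u :=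
  tsum_nonneg fun k => by positivity

lemma boundedGen_zero (q : ℝ) : boundedGen q 0 = 1 := by
  unfold boundedGen
  rw [tsum_eq_single 0]
  · simp [boundedPartitions_eq, P_zero]
  · intro k hk
    simp [boundedPartitions_zero_left k hk]

lemma boundedGen_le {q : ℝ} (hq0 : 0 ≤ q) (hq1 : q < 1) (u : ℕ) :
    boundedGen q u ≤ ∑' k : ℕ, (P k : ℝ) * q ^ k := by
  refine (summable_boundedPartitions hq0 hq1 u).tsum_le_tsum (fun k => ?_) (summable_P hq0 hq1)
  gcongr
  exact boundedPartitions_le u k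

lemma boundedGen_succ {q : ℝ} (hq0 : 0 ≤ q) (hq1 : q < 1) (u : ℕ) :
    boundedGen q (u + 1) = boundedGen q u + q ^ (u + 1) * boundedGen q (u + 1) := by
  have hs := summable_boundedPartitions hq0 hq1
  have e1 := (hs (u + 1)).sum_add_tsum_nat_add (u + 1)
  have e2 := (hs u).sum_add_tsum_nat_add (u + 1)
  have h1 : ∑ k ∈ range (u + 1), (boundedPartitions (u + 1) k : ℝ) * q ^ k =
      ∑ k ∈ range (u + 1), (boundedPartitions u k : ℝ) * q ^ k :=
    Finset.sum_congr rfl fun k hk => by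
      rw [boundedPartitions_succ_of_lt (Finset.mem_range.mp hk)]
  have h2 : ∑' k : ℕ, (boundedPartitions (u + 1) (k + (u + 1)) : ℝ) * q ^ (k + (u + 1)) =
      ∑' k : ℕ, (boundedPartitions u (k + (u + 1)) : ℝ) * q ^ (k + (u + 1)) +
        q ^ (u + 1) * boundedGen q (u + 1) := by
    unfold boundedGen
    rw [← tsum_mul_left, ← ((summable_nat_add_iff (u + 1)).mpr (hs u)).tsum_add
      ((hs (u + 1)).mul_left _)]
    refine tsum_congr fun k => ?_
    rw [boundedPartitions_succ_add]
    push_cast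
    ring
  unfold boundedGen at *
  linarith

lemma rpow_neg_two_mul_nat {t : ℝ} (ht : 1 < t) (k : ℕ) :
    t ^ (-(2 : ℝ) * k) = (t ^ (-(2 : ℝ))) ^ k := by
  rw [Real.rpow_mul (by linarith), Real.rpow_natCast]

lemma rpow_neg_two_lt_one {t : ℝ} (ht : 1 < t) : t ^ (-(2 : ℝ)) < 1 :=
  Real.rpow_lt_one_of_one_lt_of_neg ht (by norm_num)

lemma C_eq {t : ℝ} (ht : 1 < t) : C t = ∑' k : ℕ, (P k : ℝ) * (t ^ (-(2 : ℝ))) ^ k := by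
  unfold C
  simp_rw [rpow_neg_two_mul_nat ht]

lemma one_le_C {t : ℝ} (ht : 1 < t) : 1 ≤ C t := by
  have hq0 : 0 ≤ t ^ (-(2 : ℝ)) := by positivity
  rw [C_eq ht, ← boundedGen_zero (t ^ (-(2 : ℝ)))]
  exact boundedGen_le hq0 (rpow_neg_two_lt_one ht) 0

/-- The weighted sum, by area, over nonnegative paths of length `L` from height `x` to height `y`,
computed by conditioning on the first step. -/
def walkSum (t : ℝ) : ℕ → ℤ → ℤ → ℝ
  | 0, x, y => if 0 ≤ x ∧ x = y then 1 else 0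
  | L + 1, x, y =>
    if 0 ≤ x then
      t ^ ((x : ℝ) + 1 / 2) * walkSum t L (x + 1) y + t ^ ((x : ℝ) - 1 / 2) * walkSum t L (x - 1) y
    else 0

lemma walkSum_of_neg_left (t : ℝ) (L : ℕ) {x : ℤ} (hx : x < 0) (y : ℤ) : walkSum t L x y = 0 := by
  cases L <;> simp [walkSum, not_le.mpr hx]

lemma walkSum_nonneg {t : ℝ} (ht : 0 < t) (L : ℕ) (x y : ℤ) : 0 ≤ walkSum t L x y := by
  induction L generalizing x with
  | zero => unfold walkSum; split_ifs <;> norm_num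
  | succ L ih =>
    unfold walkSum
    split_ifs
    · have h1 := ih (x + 1)
      have h2 := ih (x - 1)
      positivity
    · exact le_rfl

lemma walkSum_of_far (t : ℝ) (L : ℕ) {x y : ℤ} (h : L < |x - y|) : walkSum t L x y = 0 := by
  induction L generalizing x with
  | zero =>
    unfold walkSum
    rw [if_neg]
    rintro ⟨-, rfl⟩
    simp at h
  | succ L ih =>
    push_cast at h
    unfold walkSum
    rw [lt_abs] at h
    rw [ih (x := x + 1) (by rw [lt_abs]; omega), ih (x := x - 1) (by rw [lt_abs]; omega)]
    simp

lemma walkSum_of_odd (t : ℝ) (L : ℕ) {x y : ℤ} (h : (x + L - y) % 2 = 1) :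
    walkSum t L x y = 0 := by
  induction L generalizing x with
  | zero =>
    unfold walkSum
    rw [if_neg]
    rintro ⟨-, rfl⟩
    simp at h
  | succ L ih =>
    push_cast at h
    unfold walkSum
    rw [ih (x := x + 1) (by omega), ih (x := x - 1) (by omega)]
    simp

lemma walkSum_of_neg_right (t : ℝ) (L : ℕ) (x : ℤ) {y : ℤ} (hy : y < 0) : walkSum t L x y = 0 := by
  induction L generalizing x with
  | zero =>
    unfold walkSum
    rw [if_neg]
    rintro ⟨h, rfl⟩
    omega
  | succ L ih => simp [walkSum, ih]

lemma walkSum_succ_right (t : ℝ) (L : ℕ) (x : ℤ) {y : ℤ} (hy : 0 ≤ y) :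
    walkSum t (L + 1) x y =
      t ^ ((y : ℝ) + 1 / 2) * walkSum t L x (y + 1) +
        t ^ ((y : ℝ) - 1 / 2) * walkSum t L x (y - 1) := by
  induction L generalizing x with
  | zero =>
    rcases lt_or_ge x 0 with hx | hx
    · simp [walkSum_of_neg_left t _ hx]
    simp only [walkSum, if_pos hx]
    by_cases h1 : x + 1 = y
    · subst h1
      simp [hx, hy, show x - 1 ≠ x + 1 by omega, show x ≠ x + 1 + 1 by omega]
      ring_nf
    by_cases h2 : x - 1 = y
    · subst h2
      have h3 : 1 ≤ x := by omega
      simp [hx, h3, show x + 1 ≠ x - 1 by omega, show x ≠ x - 1 - 1 by omega]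
      ring_nf
    · simp [h1, h2, show x ≠ y + 1 by omega, show x ≠ y - 1 by omega]
  | succ L ih =>
    rcases lt_or_ge x 0 with hx | hx
    · simp [walkSum_of_neg_left t _ hx]
    rw [walkSum, if_pos hx, ih, ih, walkSum, walkSum, if_pos hx, if_pos hx]
    ring

lemma walkSum_comm (t : ℝ) (L : ℕ) (x y : ℤ) : walkSum t L x y = walkSum t L y x := by
  induction L generalizing x with
  | zero =>
    unfold walkSum
    congr 1
    simp only [eq_iff_iff]
    constructor <;> rintro ⟨h, rfl⟩ <;> exact ⟨h, rfl⟩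
  | succ L ih =>
    rcases lt_or_ge x 0 with hx | hx
    · rw [walkSum_of_neg_left t _ hx, walkSum_of_neg_right t _ _ hx]
    · rw [walkSum_succ_right t L y hx, walkSum, if_pos hx, ih, ih]

lemma walkSum_add (t : ℝ) (L L' : ℕ) (x y : ℤ) (K : ℤ) (hK : x + L ≤ K) :
    walkSum t (L + L') x y = ∑ z ∈ Finset.Icc 0 K, walkSum t L x z * walkSum t L' z y := by
  induction L generalizing x with
  | zero =>
    rcases lt_or_ge x 0 with hx | hx
    · simp [walkSum_of_neg_left t _ hx]
    rw [Finset.sum_eq_single x]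
    · simp [walkSum, hx]
    · intro z _ hz
      simp [walkSum, hz.symm]
    · intro h
      simp only [Finset.mem_Icc] at h
      push_cast at hK
      omega
  | succ L ih =>
    rcases lt_or_ge x 0 with hx | hx
    · simp [walkSum_of_neg_left t _ hx]
    push_cast at hK
    rw [show L + 1 + L' = (L + L') + 1 by ring, walkSum, if_pos hx, ih (x + 1) (by omega),
      ih (x - 1) (by omega), Finset.mul_sum, Finset.mul_sum, ← Finset.sum_add_distrib]
    refine Finset.sum_congr rfl fun z _ => ?_
    rw [walkSum, if_pos hx]
    ring

/-- The area under the path from height `x` making `u` up steps followed by `d` down steps. -/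
def maxArea (x : ℤ) (u d : ℕ) : ℝ :=
  u * x + (u : ℝ) ^ 2 / 2 + d * (x + u) - (d : ℝ) ^ 2 / 2

lemma walkSum_le {t : ℝ} (ht : 1 < t) (L : ℕ) (x : ℤ) (u d : ℕ) (h : u + d = L) :
    walkSum t L x (x + u - d) ≤ t ^ maxArea x u d * boundedGen (t ^ (-(2 : ℝ))) u := by
  have ht0 : 0 < t := by linarith
  have hq0 : 0 ≤ t ^ (-(2 : ℝ)) := by positivity
  induction L generalizing x u d with
  | zero =>
    obtain ⟨rfl, rfl⟩ : u = 0 ∧ d = 0 := by omega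
    simp only [walkSum, maxArea, boundedGen_zero]
    split_ifs <;> simp
  | succ L ih =>
    have hG := boundedGen_nonneg hq0
    rcases lt_or_ge x 0 with hx | hx
    · rw [walkSum_of_neg_left t _ hx]
      exact mul_nonneg (by positivity) (hG u)
    rw [walkSum, if_pos hx]
    have hdown : t ^ ((x : ℝ) - 1 / 2) * walkSum t L (x - 1) (x + u - d) ≤
        t ^ maxArea x u d * ((t ^ (-(2 : ℝ))) ^ u * boundedGen (t ^ (-(2 : ℝ))) u) := by
      cases d with
      | zero =>
        rw [walkSum_of_far t L (by
          rw [abs_sub_comm]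
          refine lt_of_lt_of_le ?_ (le_abs_self _)
          push_cast
          omega), mul_zero]
        exact mul_nonneg (by positivity) (mul_nonneg (by positivity) (hG u))
      | succ d =>
        have := ih (x - 1) u d (by omega)
        rw [show x + (u : ℤ) - ((d + 1 : ℕ) : ℤ) = x - 1 + u - d by push_cast; ring]
        refine (mul_le_mul_of_nonneg_left this (by positivity)).trans (le_of_eq ?_)
        rw [← mul_assoc, ← mul_assoc, ← Real.rpow_add ht0, ← rpow_neg_two_mul_nat ht,
          ← Real.rpow_add ht0]
        congr 2
        unfold maxArea
        push_cast
        ring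
    cases u with
    | zero =>
      rw [walkSum_of_far t L (x := x + 1) (by
        refine lt_of_lt_of_le ?_ (le_abs_self _)
        push_cast
        omega), mul_zero, zero_add]
      simpa using hdown
    | succ u =>
      rw [boundedGen_succ hq0 (rpow_neg_two_lt_one ht), mul_add]
      refine add_le_add ?_ hdown
      have := ih (x + 1) u d (by omega)
      rw [show x + ((u + 1 : ℕ) : ℤ) - d = x + 1 + u - d by push_cast; ring]
      refine (mul_le_mul_of_nonneg_left this (by positivity)).trans (le_of_eq ?_)
      rw [← mul_assoc, ← Real.rpow_add ht0]
      congr 2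
      unfold maxArea
      push_cast
      ring

lemma le_walkSum {t : ℝ} (ht : 0 < t) (L : ℕ) (x : ℤ) (u d : ℕ) (h : u + d = L) (hx : 0 ≤ x)
    (hy : 0 ≤ x + u - d) : t ^ maxArea x u d ≤ walkSum t L x (x + u - d) := by
  induction L generalizing x u d with
  | zero =>
    obtain ⟨rfl, rfl⟩ : u = 0 ∧ d = 0 := by omega
    simp [walkSum, maxArea, hx]
  | succ L ih =>
    rw [walkSum, if_pos hx]
    cases u with
    | zero =>
      obtain ⟨d, rfl⟩ : ∃ e, d = e + 1 := ⟨d - 1, by omega⟩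
      push_cast at hy
      have := ih (x - 1) 0 d (by omega) (by omega) (by push_cast; omega)
      rw [show x + ((0 : ℕ) : ℤ) - ((d + 1 : ℕ) : ℤ) = x - 1 + (0 : ℕ) - d by push_cast; ring]
      refine le_trans (le_of_eq ?_) (le_add_of_nonneg_of_le
        (mul_nonneg (by positivity) (walkSum_nonneg ht _ _ _))
        (mul_le_mul_of_nonneg_left this (by positivity)))
      rw [← Real.rpow_add ht]
      congr 1
      unfold maxArea
      push_cast
      ring
    | succ u =>
      push_cast at hy
      have := ih (x + 1) u d (by omega) (by omega) (by omega)
      rw [show x + ((u + 1 : ℕ) : ℤ) - d = x + 1 + u - d by push_cast; ring]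
      refine le_trans (le_of_eq ?_) (le_add_of_le_of_nonneg
        (mul_le_mul_of_nonneg_left this (by positivity))
        (mul_nonneg (by positivity) (walkSum_nonneg ht _ _ _)))
      rw [← Real.rpow_add ht]
      congr 1
      unfold maxArea
      push_cast
      ring

lemma height_zero {L : ℕ} (w : Fin L → Bool) : height w 0 = 0 := by
  simp [height]

lemma height_cons {L : ℕ} (b : Bool) (w : Fin L → Bool) (i : ℕ) :
    height (Fin.cons b w : Fin (L + 1) → Bool) (i + 1) =
      (if b then (1 : ℤ) else -1) + height w i := by
  unfold height
  rw [Finset.sum_filter, Finset.sum_filter, Fin.sum_univ_succ]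
  simp

lemma area_cons {L : ℕ} (b : Bool) (w : Fin L → Bool) :
    area (Fin.cons b w : Fin (L + 1) → Bool) =
      (((if b then (1 : ℤ) else -1) : ℤ) : ℝ) * (L + 1 / 2) + area w := by
  unfold area
  rw [Finset.sum_range_succ']
  simp only [height_cons, height_zero, zero_add]
  push_cast
  simp only [Finset.sum_add_distrib, Finset.sum_const, Finset.card_range, nsmul_eq_mul]
  ring

lemma walkSum_eq_sum {t : ℝ} (ht : 0 < t) (L : ℕ) (x y : ℤ) :
    walkSum t L x y = ∑ w : Fin L → Bool,
      if (∀ i ≤ L, 0 ≤ x + height w i) ∧ x + height w L = y then t ^ (L * (x : ℝ) + area w)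
      else 0 := by
  induction L generalizing x with
  | zero => simp [walkSum, height_zero, area]
  | succ L ih =>
    rw [← (Fin.consEquiv fun _ : Fin (L + 1) => Bool).sum_comp, Fintype.sum_prod_type,
      Fintype.sum_bool, walkSum]
    have key : ∀ b : Bool, 0 ≤ x →
        (∑ w : Fin L → Bool,
          if (∀ i ≤ L + 1, 0 ≤ x + height (Fin.cons b w : Fin (L + 1) → Bool) i) ∧
              x + height (Fin.cons b w : Fin (L + 1) → Bool) (L + 1) = y
          then t ^ (((L + 1 : ℕ) : ℝ) * (x : ℝ) + area (Fin.cons b w : Fin (L + 1) → Bool))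
          else 0) =
        t ^ ((x : ℝ) + (((if b then (1 : ℤ) else -1) : ℤ) : ℝ) / 2) *
          walkSum t L (x + if b then (1 : ℤ) else -1) y := by
      intro b hx
      rw [ih, Finset.mul_sum]
      refine Finset.sum_congr rfl fun w _ => ?_
      have hiff : (∀ i ≤ L + 1, 0 ≤ x + height (Fin.cons b w : Fin (L + 1) → Bool) i) ↔
          ∀ i ≤ L, 0 ≤ x + (if b then (1 : ℤ) else -1) + height w i := by
        constructor
        · intro h i hi
          have := h (i + 1) (by omega)
          rwa [height_cons, ← add_assoc] at this
        · intro h i hi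
          cases i with
          | zero => simpa [height_zero] using hx
          | succ i =>
            rw [height_cons, ← add_assoc]
            exact h i (by omega)
      rw [mul_ite, mul_zero, ← Real.rpow_add ht, area_cons]
      refine if_congr (and_congr hiff (by rw [height_cons, ← add_assoc])) ?_ rfl
      congr 1
      push_cast
      ring
    by_cases hx : 0 ≤ x
    · rw [if_pos hx]
      refine Eq.symm ((congrArg₂ (· + ·) (key true hx) (key false hx)).trans ?_)
      simp only [if_true, Bool.false_eq_true, if_false]
      push_cast
      ring_nf
    · rw [if_neg hx]
      have hz : ∀ v : Fin (L + 1) → Bool,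
          ¬ ((∀ i ≤ L + 1, 0 ≤ x + height v i) ∧ x + height v (L + 1) = y) := by
        rintro v ⟨h, -⟩
        have := h 0 (by omega)
        rw [height_zero] at this
        omega
      simp [hz]

lemma height_length {L : ℕ} (w : Fin L → Bool) :
    height w L = 2 * ((Finset.univ.filter fun j => w j = true).card : ℤ) - L := by
  unfold height
  rw [Finset.filter_true_of_mem (by simp), Finset.card_filter]
  push_cast
  have : (L : ℤ) = ∑ _j : Fin L, (1 : ℤ) := by simp
  rw [this, Finset.mul_sum, ← Finset.sum_sub_distrib]
  refine Finset.sum_congr rfl fun j _ => ?_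
  split_ifs <;> norm_num

lemma M_eq_walkSum {t : ℝ} (ht : 0 < t) (a b : ℕ) : M a b t = walkSum t (2 * a + b) 0 b := by
  rw [walkSum_eq_sum ht, M, DyckSet, Finset.sum_filter]
  refine Finset.sum_congr rfl fun w _ => ?_
  have h := height_length w
  refine if_congr ?_ (by simp) rfl
  rw [and_comm]
  simp only [zero_add]
  refine and_congr Iff.rfl ?_
  push_cast at h
  omega

lemma Mlm_eq_walkSum {t : ℝ} (ht : 0 < t) (a b : ℕ) :
    Mlm (2 * a + b) b t = walkSum t (2 * a + b) 0 b := by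
  rw [Mlm, show (2 * a + b - b) / 2 = a by omega, M_eq_walkSum ht]

lemma maxArea_zero (a b : ℕ) :
    maxArea 0 (a + b) a = ((a : ℝ) + b) ^ 2 - (b : ℝ) ^ 2 / 2 := by
  unfold maxArea
  push_cast
  ring

lemma Mlm_le {t : ℝ} (ht : 1 < t) (a b : ℕ) :
    Mlm (2 * a + b) b t ≤ t ^ (((a : ℝ) + b) ^ 2 - (b : ℝ) ^ 2 / 2) * C t := by
  have ht0 : 0 < t := by linarith
  have h := walkSum_le ht (2 * a + b) 0 (a + b) a (by ring)
  rw [maxArea_zero, show (0 : ℤ) + ((a + b : ℕ) : ℤ) - a = b by push_cast; ring] at h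
  rw [Mlm_eq_walkSum ht0, C_eq ht]
  refine h.trans ?_
  gcongr
  exact boundedGen_le (by positivity) (rpow_neg_two_lt_one ht) _

lemma le_Mlm {t : ℝ} (ht : 0 < t) (a b : ℕ) :
    t ^ (((a : ℝ) + b) ^ 2 - (b : ℝ) ^ 2 / 2) ≤ Mlm (2 * a + b) b t := by
  have h := le_walkSum ht (2 * a + b) 0 (a + b) a (by ring) le_rfl (by push_cast; omega)
  rw [maxArea_zero, show (0 : ℤ) + ((a + b : ℕ) : ℤ) - a = b by push_cast; ring] at h
  rwa [Mlm_eq_walkSum ht]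

lemma Mlm_pos {t : ℝ} (ht : 0 < t) (a b : ℕ) : 0 < Mlm (2 * a + b) b t :=
  lt_of_lt_of_le (by positivity) (le_Mlm ht a b)

/-- Splitting a Dyck path of length `2n` at step `n1`. -/
lemma sum_Mlm_mul_Mlm {t : ℝ} (ht : 0 < t) {n n1 : ℕ} (h : n1 ≤ n) :
    ∑ N ∈ Finset.range (n1 / 2 + 1), Mlm n1 (n1 - 2 * N) t * Mlm (2 * n - n1) (n1 - 2 * N) t =
      Mlm (2 * n) 0 t := by
  have h0 := Mlm_eq_walkSum ht n 0
  simp only [add_zero, Nat.cast_zero] at h0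
  rw [h0]
  conv_rhs => rw [show 2 * n = n1 + (2 * n - n1) by omega]
  rw [walkSum_add t n1 (2 * n - n1) 0 0 n1 (by simp)]
  refine Finset.sum_of_injOn (fun N : ℕ => ((n1 - 2 * N : ℕ) : ℤ)) ?_ ?_ ?_ ?_
  · intro i hi j hj hij
    simp only [Finset.coe_range, Set.mem_Iio] at hi hj
    simp only [Nat.cast_inj] at hij
    omega
  · intro N _
    simp only [Finset.coe_Icc, Set.mem_Icc]
    omega
  · intro z hz hz'
    rw [walkSum_of_odd t n1, zero_mul]
    by_contra hodd
    apply hz'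
    simp only [Finset.mem_Icc] at hz
    refine ⟨((n1 - z) / 2).toNat, ?_, ?_⟩
    · simp only [Finset.coe_range, Set.mem_Iio]
      omega
    · simp only
      omega
  · intro N hN
    have hN' := Finset.mem_range.mp hN
    obtain ⟨m, hm⟩ : ∃ m, n1 = 2 * N + m := ⟨n1 - 2 * N, by omega⟩
    obtain ⟨e, he⟩ : ∃ e, n = n1 + e := ⟨n - n1, by omega⟩
    have e1 : n1 - 2 * N = m := by omega
    have e2 : 2 * n - n1 = 2 * (N + e) + m := by omega
    rw [e1, e2, Mlm_eq_walkSum ht, walkSum_comm t _ (m : ℤ) 0, hm, Mlm_eq_walkSum ht]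

lemma schmidt_le {t : ℝ} (ht : 1 < t) {n n1 N : ℕ} (h : n1 ≤ n) (hN : 2 * N ≤ n1) :
    Mlm n1 (n1 - 2 * N) t * Mlm (2 * n - n1) (n1 - 2 * N) t / Mlm (2 * n) 0 t ≤
      C t ^ 2 * t ^ (-(2 : ℝ) * N ^ 2) := by
  have ht0 : 0 < t := by linarith
  obtain ⟨m, rfl⟩ : ∃ m, n1 = 2 * N + m := ⟨n1 - 2 * N, by omega⟩
  obtain ⟨e, rfl⟩ : ∃ e, n = 2 * N + m + e := ⟨n - (2 * N + m), by omega⟩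
  have hpos := Mlm_pos ht0 (2 * N + m + e) 0
  have hlow := le_Mlm ht0 (2 * N + m + e) 0
  rw [add_zero] at hpos hlow
  rw [Nat.add_sub_cancel_left,
    show 2 * (2 * N + m + e) - (2 * N + m) = 2 * (N + e) + m by omega, div_le_iff₀ hpos]
  have hC := one_le_C ht
  calc Mlm (2 * N + m) m t * Mlm (2 * (N + e) + m) m t
      ≤ (t ^ (((N : ℝ) + m) ^ 2 - (m : ℝ) ^ 2 / 2) * C t) *
        (t ^ ((((N + e : ℕ) : ℝ) + m) ^ 2 - (m : ℝ) ^ 2 / 2) * C t) :=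
        mul_le_mul (Mlm_le ht N m) (Mlm_le ht (N + e) m) (Mlm_pos ht0 _ _).le (by positivity)
    _ = C t ^ 2 * t ^ (((N : ℝ) + m) ^ 2 - (m : ℝ) ^ 2 / 2 +
          ((((N + e : ℕ) : ℝ) + m) ^ 2 - (m : ℝ) ^ 2 / 2)) := by
        rw [Real.rpow_add ht0]
        ring
    _ ≤ C t ^ 2 * t ^ (-(2 : ℝ) * N ^ 2 +
          ((((2 * N + m + e : ℕ) : ℝ) + (0 : ℕ)) ^ 2 - ((0 : ℕ) : ℝ) ^ 2 / 2)) := by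
        refine mul_le_mul_of_nonneg_left (Real.rpow_le_rpow_of_exponent_le ht.le ?_)
          (by positivity)
        push_cast
        have : (0 : ℝ) ≤ N * e := by positivity
        nlinarith
    _ ≤ _ := by
        rw [Real.rpow_add ht0, ← mul_assoc]
        gcongr

section Entropy

variable {ι : Type*} (S : Finset ι) (w m : ι → ℝ) {σ κ κ' : ℝ}

lemma rpow_mul_rpow_eq (hσ : 0 < σ) {x : ℝ} (hx : 0 < x) (y : ℝ) :
    σ ^ ((1 - κ) * y) * x ^ κ = x * (σ ^ y / x) ^ (1 - κ) := by
  rw [Real.div_rpow (by positivity) hx.le, ← Real.rpow_mul hσ.le, mul_comm y, mul_div_assoc',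
    mul_comm x, mul_div_assoc]
  congr 1
  nth_rw 2 [← Real.rpow_one x]
  rw [← Real.rpow_sub hx]
  congr 1
  ring

/-- The Rényi entropy dominates the average of the logarithms of the multiplicities `σ ^ m i`. -/
lemma mean_le_renyi (hσ : 1 ≤ σ) (hκ1 : κ < 1) (hw : ∀ i ∈ S, 0 < w i)
    (hw1 : ∑ i ∈ S, w i = 1) :
    Real.log σ * ∑ i ∈ S, w i * m i ≤
      1 / (1 - κ) * Real.log (∑ i ∈ S, σ ^ ((1 - κ) * m i) * w i ^ κ) := by
  have hσ0 : 0 < σ := by linarith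
  have hκ : 0 < 1 - κ := by linarith
  have hpos : ∀ i ∈ S, 0 < (σ ^ m i / w i) ^ (1 - κ) := fun i hi => by
    have := hw i hi
    positivity
  rw [Finset.sum_congr rfl fun i hi => rpow_mul_rpow_eq hσ0 (hw i hi) (m i)]
  have hj := strictConcaveOn_log_Ioi.concaveOn.le_map_sum (fun i hi => (hw i hi).le) hw1 hpos
  simp only [smul_eq_mul] at hj
  refine le_trans ?_ (mul_le_mul_of_nonneg_left hj (by positivity))
  rw [Finset.mul_sum, Finset.mul_sum]
  refine Finset.sum_le_sum fun i hi => ?_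
  have hwi := hw i hi
  have hwi1 : w i ≤ 1 := hw1 ▸ Finset.single_le_sum (fun j hj => (hw j hj).le) hi
  rw [Real.log_rpow (by positivity), Real.log_div (by positivity) hwi.ne', Real.log_rpow hσ0]
  have hlog : Real.log (w i) ≤ 0 := Real.log_nonpos hwi.le hwi1
  have e : 1 / (1 - κ) * (w i * ((1 - κ) * (m i * Real.log σ - Real.log (w i)))) =
      w i * (m i * Real.log σ - Real.log (w i)) := by
    field_simp
  rw [e]
  nlinarith

/-- The Rényi entropy is antitone in its order. -/
lemma renyi_anti (hσ : 0 < σ) (hκκ : κ' ≤ κ) (hκ1 : κ < 1) (hw : ∀ i ∈ S, 0 < w i)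
    (hw1 : ∑ i ∈ S, w i = 1) :
    1 / (1 - κ) * Real.log (∑ i ∈ S, σ ^ ((1 - κ) * m i) * w i ^ κ) ≤
      1 / (1 - κ') * Real.log (∑ i ∈ S, σ ^ ((1 - κ') * m i) * w i ^ κ') := by
  have hκ : 0 < 1 - κ := by linarith
  have hκ' : 0 < 1 - κ' := by linarith
  have hne : S.Nonempty := by
    rw [Finset.nonempty_iff_ne_empty]
    rintro rfl
    simp at hw1
  have hpos : ∀ α : ℝ, 0 < ∑ i ∈ S, w i * (σ ^ m i / w i) ^ α := fun α =>
    Finset.sum_pos (fun i hi => by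
      have := hw i hi
      positivity) hne
  rw [Finset.sum_congr rfl fun i hi => rpow_mul_rpow_eq hσ (hw i hi) (m i),
    Finset.sum_congr rfl fun i hi => rpow_mul_rpow_eq (κ := κ') hσ (hw i hi) (m i)]
  have hp : 1 ≤ (1 - κ') / (1 - κ) := by
    rw [le_div_iff₀ hκ]
    linarith
  have hmean := Real.arith_mean_le_rpow_mean S w (fun i => (σ ^ m i / w i) ^ (1 - κ))
    (fun i hi => (hw i hi).le) hw1 (fun i hi => by
      have := hw i hi
      positivity) hp
  have hexp : ∀ i ∈ S, w i * ((σ ^ m i / w i) ^ (1 - κ)) ^ ((1 - κ') / (1 - κ)) =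
      w i * (σ ^ m i / w i) ^ (1 - κ') := fun i hi => by
    have := hw i hi
    rw [← Real.rpow_mul (by positivity), mul_div_cancel₀ _ hκ.ne']
  rw [Finset.sum_congr rfl hexp] at hmean
  have hlog := Real.log_le_log (hpos _) hmean
  rw [Real.log_rpow (hpos _)] at hlog
  refine (mul_le_mul_of_nonneg_left hlog (by positivity)).trans (le_of_eq ?_)
  field_simp

end Entropy

lemma summable_mul_rpow_neg_sq {t : ℝ} (ht : 1 < t) :
    Summable fun N : ℕ => (N : ℝ) * t ^ (-(2 : ℝ) * N ^ 2) := by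
  have hq0 : 0 ≤ t ^ (-(2 : ℝ)) := by positivity
  have hs := summable_pow_mul_geometric_of_norm_lt_one (R := ℝ) 1 (r := t ^ (-(2 : ℝ)))
    (by rw [Real.norm_of_nonneg hq0]; exact rpow_neg_two_lt_one ht)
  refine hs.of_nonneg_of_le (fun N => by positivity) fun N => ?_
  rw [pow_one, ← rpow_neg_two_mul_nat ht]
  have : (N : ℝ) ≤ (N : ℝ) ^ 2 := mod_cast Nat.le_self_pow two_ne_zero N
  refine mul_le_mul_of_nonneg_left (Real.rpow_le_rpow_of_exponent_le ht.le ?_) N.cast_nonneg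
  linarith

lemma summable_rpow_mul_rpow_neg_sq {t σ κ' : ℝ} (ht : 1 < t) (hσ : 1 ≤ σ) (hκ0 : 0 < κ')
    (hκ1 : κ' < 1) :
    Summable fun N : ℕ => σ ^ (-(2 : ℝ) * (1 - κ') * N) * t ^ (-(2 : ℝ) * κ' * N ^ 2) := by
  have hq1 : t ^ (-(2 : ℝ) * κ') < 1 := Real.rpow_lt_one_of_one_lt_of_neg ht (by linarith)
  refine (summable_geometric_of_lt_one (by positivity) hq1).of_nonneg_of_le
    (fun N => by positivity) fun N => ?_
  have h1 : σ ^ (-(2 : ℝ) * (1 - κ') * N) ≤ 1 := by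
    refine Real.rpow_le_one_of_one_le_of_nonpos hσ ?_
    have : 0 ≤ (1 - κ') * (N : ℝ) := mul_nonneg (by linarith) (by positivity)
    linarith
  have h2 : t ^ (-(2 : ℝ) * κ' * N ^ 2) ≤ (t ^ (-(2 : ℝ) * κ')) ^ N := by
    rw [← Real.rpow_natCast (t ^ (-(2 : ℝ) * κ')), ← Real.rpow_mul (zero_le_one.trans ht.le)]
    refine Real.rpow_le_rpow_of_exponent_le ht.le ?_
    have : (N : ℝ) ≤ (N : ℝ) ^ 2 := mod_cast Nat.le_self_pow two_ne_zero N
    nlinarith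
  calc _ ≤ 1 * (t ^ (-(2 : ℝ) * κ')) ^ N := mul_le_mul h1 h2 (by positivity) zero_le_one
    _ = _ := one_mul _

/-- Bounds on the Rényi entropy of order `0 < κ < 1`:
`n1 log s + D1(s,t) ≤ S^κ_{n1}(s,t) < n1 log s + (2κ/(2-κ)) log C(t) + (2/(2-κ)) log D4(s,t,κ/2)`. -/
theorem stmt_16 (t κ : ℝ) (ht : 1 < t) (hκ0 : 0 < κ) (hκ1 : κ < 1) (s : ℕ) (hs : 1 ≤ s)
    (n n1 : ℕ) (hn : 1 ≤ n) (hn1 : 1 ≤ n1) (h : n1 ≤ n) :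
    let lam : ℕ → ℝ := fun N' =>
      Mlm n1 (n1 - 2 * N') t * Mlm (2 * n - n1) (n1 - 2 * N') t / Mlm (2 * n) 0 t
    let Sκ := (1 / (1 - κ)) * Real.log (∑ N' ∈ Finset.range (n1 / 2 + 1),
      (s : ℝ) ^ ((1 - κ) * ((n1 - 2 * N' : ℕ) : ℝ)) * lam N' ^ κ)
    let D1 := -2 * C t ^ 2 * Real.log s * ∑' N' : ℕ, (N' : ℝ) * t ^ (-(2 : ℝ) * N' ^ 2)
    let D4 : ℝ → ℝ := fun κ' =>
      ∑' N' : ℕ, (s : ℝ) ^ (-(2 : ℝ) * (1 - κ') * N') * t ^ (-(2 : ℝ) * κ' * N' ^ 2)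
    (n1 : ℝ) * Real.log s + D1 ≤ Sκ ∧
    Sκ < (n1 : ℝ) * Real.log s + (2 * κ / (2 - κ)) * Real.log (C t)
        + (2 / (2 - κ)) * Real.log (D4 (κ / 2)) := by
  intro lam Sκ D1 D4
  have ht0 : 0 < t := by linarith
  have hs1 : (1 : ℝ) ≤ s := by exact_mod_cast hs
  have hs0 : (0 : ℝ) < s := by linarith
  have hC := one_le_C ht
  have hrange : ∀ N ∈ Finset.range (n1 / 2 + 1), 2 * N ≤ n1 := fun N hN => by
    have := Finset.mem_range.mp hN
    omega
  have hcast : ∀ N ∈ Finset.range (n1 / 2 + 1), ((n1 - 2 * N : ℕ) : ℝ) = n1 - 2 * N :=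
    fun N hN => by
      rw [Nat.cast_sub (hrange N hN)]
      push_cast
      ring
  have hden : 0 < Mlm (2 * n) 0 t := Mlm_pos ht0 n 0
  have hlam_pos : ∀ N ∈ Finset.range (n1 / 2 + 1), 0 < lam N := fun N hN => by
    obtain ⟨m, hm⟩ : ∃ m, n1 = 2 * N + m := ⟨n1 - 2 * N, by have := hrange N hN; omega⟩
    obtain ⟨e, he⟩ : ∃ e, n = n1 + e := ⟨n - n1, by omega⟩
    have e1 : n1 - 2 * N = m := by omega
    have e2 : 2 * n - n1 = 2 * (N + e) + m := by omega
    refine div_pos ?_ hden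
    rw [e1, e2, hm]
    exact mul_pos (Mlm_pos ht0 _ _) (Mlm_pos ht0 _ _)
  have hlam_sum : ∑ N ∈ Finset.range (n1 / 2 + 1), lam N = 1 := by
    simp only [lam]
    rw [← Finset.sum_div, sum_Mlm_mul_Mlm ht0 h, div_self hden.ne']
  have hlam_le : ∀ N ∈ Finset.range (n1 / 2 + 1), lam N ≤ C t ^ 2 * t ^ (-(2 : ℝ) * N ^ 2) :=
    fun N hN => schmidt_le ht h (hrange N hN)
  constructor
  · refine le_trans ?_ (mean_le_renyi _ lam (fun N => ((n1 - 2 * N : ℕ) : ℝ)) hs1 hκ1 hlam_pos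
      hlam_sum)
    have hmean : ∑ N ∈ Finset.range (n1 / 2 + 1), lam N * ((n1 - 2 * N : ℕ) : ℝ) =
        n1 - 2 * ∑ N ∈ Finset.range (n1 / 2 + 1), N * lam N := by
      rw [Finset.sum_congr rfl fun N hN => by rw [hcast N hN, mul_sub]]
      rw [Finset.sum_sub_distrib, ← Finset.sum_mul, hlam_sum, one_mul, Finset.mul_sum]
      congr 1
      exact Finset.sum_congr rfl fun N _ => by ring
    have hdef : ∑ N ∈ Finset.range (n1 / 2 + 1), N * lam N ≤
        C t ^ 2 * ∑' N : ℕ, (N : ℝ) * t ^ (-(2 : ℝ) * N ^ 2) := by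
      refine le_trans ?_ (mul_le_mul_of_nonneg_left
        ((summable_mul_rpow_neg_sq ht).sum_le_tsum (Finset.range (n1 / 2 + 1))
          fun N _ => by positivity) (by positivity))
      rw [Finset.mul_sum]
      refine Finset.sum_le_sum fun N hN => ?_
      exact (mul_le_mul_of_nonneg_left (hlam_le N hN) (Nat.cast_nonneg N)).trans
        (le_of_eq (by ring))
    rw [hmean]
    have hlog : 0 ≤ Real.log s := Real.log_nonneg hs1
    have := mul_le_mul_of_nonneg_left hdef hlog
    simp only [D1]
    nlinarith
  · have hκ2 : 0 < 2 - κ := by linarith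
    refine lt_of_le_of_lt (renyi_anti _ lam (fun N => ((n1 - 2 * N : ℕ) : ℝ)) (κ' := κ / 2) hs0
      (by linarith) hκ1 hlam_pos hlam_sum) ?_
    have hsum := summable_rpow_mul_rpow_neg_sq (κ' := κ / 2) ht hs1 (by linarith) (by linarith)
    have hterm : ∀ N : ℕ, 0 < (s : ℝ) ^ (-(2 : ℝ) * (1 - κ / 2) * N) *
        t ^ (-(2 : ℝ) * (κ / 2) * N ^ 2) := fun N => by positivity
    have hD4 : ∑ N ∈ Finset.range (n1 / 2 + 1), (s : ℝ) ^ (-(2 : ℝ) * (1 - κ / 2) * N) *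
        t ^ (-(2 : ℝ) * (κ / 2) * N ^ 2) < D4 (κ / 2) := by
      refine lt_of_lt_of_le ?_ (hsum.sum_le_tsum (Finset.range (n1 / 2 + 1 + 1))
        fun N _ => (hterm N).le)
      rw [Finset.sum_range_succ _ (n1 / 2 + 1)]
      exact lt_add_of_pos_right _ (hterm _)
    have hD4_pos : 0 < D4 (κ / 2) :=
      lt_of_le_of_lt (Finset.sum_nonneg fun N _ => (hterm N).le) hD4
    have hbound : ∑ N ∈ Finset.range (n1 / 2 + 1),
        (s : ℝ) ^ ((1 - κ / 2) * ((n1 - 2 * N : ℕ) : ℝ)) * lam N ^ (κ / 2) <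
          (s : ℝ) ^ ((1 - κ / 2) * n1) * C t ^ κ * D4 (κ / 2) := by
      refine lt_of_le_of_lt ?_ (mul_lt_mul_of_pos_left hD4 (by positivity))
      rw [Finset.mul_sum]
      refine Finset.sum_le_sum fun N hN => ?_
      have h1 : lam N ^ (κ / 2) ≤ C t ^ κ * t ^ (-(2 : ℝ) * (κ / 2) * N ^ 2) := by
        refine (Real.rpow_le_rpow (hlam_pos N hN).le (hlam_le N hN) (by linarith)).trans
          (le_of_eq ?_)
        rw [Real.mul_rpow (by positivity) (by positivity), ← Real.rpow_natCast,
          ← Real.rpow_mul (by linarith), ← Real.rpow_mul ht0.le]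
        congr 2
        · push_cast
          ring
        · ring
      refine (mul_le_mul_of_nonneg_left h1 (by positivity)).trans (le_of_eq ?_)
      rw [hcast N hN, show (1 - κ / 2) * ((n1 : ℝ) - 2 * N) =
        (1 - κ / 2) * n1 + -(2 : ℝ) * (1 - κ / 2) * N by ring, Real.rpow_add hs0]
      ring
    have hpos : 0 < ∑ N ∈ Finset.range (n1 / 2 + 1),
        (s : ℝ) ^ ((1 - κ / 2) * ((n1 - 2 * N : ℕ) : ℝ)) * lam N ^ (κ / 2) :=
      Finset.sum_pos (fun N hN => by
        have := hlam_pos N hN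
        positivity) ⟨0, by simp⟩
    have hC0 : 0 < C t := by linarith
    have hlog := Real.log_lt_log hpos hbound
    rw [Real.log_mul (by positivity) hD4_pos.ne', Real.log_mul (by positivity) (by positivity),
      Real.log_rpow hs0, Real.log_rpow hC0] at hlog
    have hκ3 : 0 < 1 - κ / 2 := by linarith
    refine (mul_lt_mul_of_pos_left hlog (by positivity)).trans_eq ?_
    have e : (1 : ℝ) - κ / 2 = (2 - κ) / 2 := by ring
    rw [e]
    field_simp
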